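/- Let κ be a perfect kernel on X and let f = U^{ϑ⁺} − U^{ϑ⁻} with ϑ⁺, ϑ⁻ ∈ E⁺ (an external field with ψ = 0), and let A ⊆ X with w_f(A) < ∞. Suppose the solution λ_{A,f} of the inner Gauss variational problem for (A, f) exists; then so does λ_{K,f} for all sufficiently large compact K ⊆ A, and the f-weighted equilibrium constants c_{K,f} := ∫ U_f^{λ_{K,f}} dλ_{K,f} converge as K ↑ A to c_{A,f} := ∫ U_f^{λ_{A,f}} dλ_{A,f}. -/

import Mathlib

open MeasureTheory Topology Filter Set ENNReal

noncomputable section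

namespace GaussVar

variable {X : Type*} [TopologicalSpace X] [MeasurableSpace X]

/-- A (positive) Radon measure: a regular Borel measure. -/
def IsRadon (μ : Measure X) : Prop := μ.Regular

/-- The mutual energy `I(μ,ν) = ∬ κ(x,y) d(μ⊗ν)(x,y)`. -/
def mutualEnergy (κ : X → X → ℝ≥0∞) (μ ν : Measure X) : ℝ≥0∞ :=
  ∫⁻ p : X × X, κ p.1 p.2 ∂(μ.prod ν)

/-- The energy `I(μ) := I(μ,μ)`. -/
def energy (κ : X → X → ℝ≥0∞) (μ : Measure X) : ℝ≥0∞ := mutualEnergy κ μ μ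

/-- Membership in the cone `E⁺` of Radon measures with finite energy. -/
def memEplus (κ : X → X → ℝ≥0∞) (μ : Measure X) : Prop :=
  IsRadon μ ∧ energy κ μ < ⊤

/-- A kernel: symmetric and lower semicontinuous with values in `[0,∞]`. -/
def IsKernel (κ : X → X → ℝ≥0∞) : Prop :=
  (∀ x y, κ x y = κ y x) ∧ LowerSemicontinuous (fun p : X × X => κ p.1 p.2)

/-- The strong (energy) metric `d(μ,ν) := (I(μ)+I(ν)−2I(μ,ν))^{1/2}` on `E⁺`. -/
def strongDist (κ : X → X → ℝ≥0∞) (μ ν : Measure X) : ℝ :=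
  Real.sqrt ((energy κ μ).toReal + (energy κ ν).toReal - 2 * (mutualEnergy κ μ ν).toReal)

/-- The energy principle (strict positive definiteness). -/
def EnergyPrinciple (κ : X → X → ℝ≥0∞) : Prop :=
  ∀ μ ν : Measure X, memEplus κ μ → memEplus κ ν →
    2 * mutualEnergy κ μ ν ≤ energy κ μ + energy κ ν ∧
      (2 * mutualEnergy κ μ ν = energy κ μ + energy κ ν → μ = ν)

/-- Convergence of a sequence in the strong metric. -/
def StrongTendstoSeq (κ : X → X → ℝ≥0∞) (μ : ℕ → Measure X) (μ₀ : Measure X) : Prop :=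
  Tendsto (fun n => strongDist κ (μ n) μ₀) atTop (𝓝 0)

/-- Vague convergence of a sequence of measures. -/
def VagueTendstoSeq (μ : ℕ → Measure X) (μ₀ : Measure X) : Prop :=
  ∀ φ : X → ℝ, Continuous φ → HasCompactSupport φ →
    Tendsto (fun n => ∫ x, φ x ∂(μ n)) atTop (𝓝 (∫ x, φ x ∂μ₀))

/-- Cauchy sequence in the strong metric. -/
def StrongCauchySeq (κ : X → X → ℝ≥0∞) (μ : ℕ → Measure X) : Prop :=
  ∀ ε : ℝ, 0 < ε → ∃ N : ℕ, ∀ m ≥ N, ∀ n ≥ N, strongDist κ (μ m) (μ n) < ε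

/-- A perfect kernel: satisfies the energy principle, `(E⁺,d)` is complete, and
strong convergence implies vague convergence. -/
def IsPerfect (κ : X → X → ℝ≥0∞) : Prop :=
  EnergyPrinciple κ ∧
    (∀ μ : ℕ → Measure X, (∀ n, memEplus κ (μ n)) → StrongCauchySeq κ μ →
        ∃ μ₀ : Measure X, memEplus κ μ₀ ∧ StrongTendstoSeq κ μ μ₀) ∧
    (∀ (μ : ℕ → Measure X) (μ₀ : Measure X), (∀ n, memEplus κ (μ n)) → memEplus κ μ₀ →
        StrongTendstoSeq κ μ μ₀ → VagueTendstoSeq μ μ₀)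

/-- `μ` is concentrated on `A`: the complement of `A` is locally `μ`-negligible. -/
def Concentrated (μ : Measure X) (A : Set X) : Prop :=
  ∀ K : Set X, IsCompact K → μ (Aᶜ ∩ K) = 0

/-- Membership in `Ĕ⁺(A)`: finite-energy Radon measures concentrated on `A`
of unit total mass. -/
def memBreve (κ : X → X → ℝ≥0∞) (A : Set X) (μ : Measure X) : Prop :=
  memEplus κ μ ∧ Concentrated μ A ∧ μ Set.univ = 1

/-- `w(A) := inf { I(μ) : μ ∈ Ĕ⁺(A) }` (with `inf ∅ = ⊤`). -/
def wcap (κ : X → X → ℝ≥0∞) (A : Set X) : ℝ≥0∞ :=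
  ⨅ (μ : Measure X) (_ : memBreve κ A μ), energy κ μ

/-- The inner capacity `cap_*(A) := 1 / w(A)`. -/
def innerCap (κ : X → X → ℝ≥0∞) (A : Set X) : ℝ≥0∞ := (wcap κ A)⁻¹

/-- The outer capacity `cap^*(E) := inf { cap_*(D) : D open, E ⊆ D }`. -/
def outerCap (κ : X → X → ℝ≥0∞) (E : Set X) : ℝ≥0∞ :=
  ⨅ (D : Set X) (_ : IsOpen D ∧ E ⊆ D), innerCap κ D

/-- `P` holds nearly everywhere (n.e.) on `A`: the exceptional subset of `A`
has inner capacity zero. -/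
def NearlyEverywhere (κ : X → X → ℝ≥0∞) (A : Set X) (P : X → Prop) : Prop :=
  innerCap κ {x ∈ A | ¬ P x} = 0

/-- The potential `U^μ(x) := ∫ κ(x,y) dμ(y)`. -/
def potential (κ : X → X → ℝ≥0∞) (μ : Measure X) (x : X) : ℝ≥0∞ :=
  ∫⁻ y, κ x y ∂μ

/-- An external field: `f = ψ + U^{ϑ⁺} − U^{ϑ⁻}` where `ψ` is lower semicontinuous,
`(−∞,∞]`-valued, positive if `X` is noncompact, and `ϑ⁺, ϑ⁻ ∈ E⁺`. -/
def IsExternalField (κ : X → X → ℝ≥0∞) (f : X → EReal) : Prop :=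
  ∃ (ψ : X → EReal) (ϑp ϑm : Measure X),
    LowerSemicontinuous ψ ∧ (∀ x, ψ x ≠ ⊥) ∧ (¬ CompactSpace X → ∀ x, 0 ≤ ψ x) ∧
    memEplus κ ϑp ∧ memEplus κ ϑm ∧
    ∀ x, f x = ψ x + (potential κ ϑp x : EReal) - (potential κ ϑm x : EReal)

/-- `f` is `μ`-integrable (as an extended-real-valued function). -/
def FieldIntegrable (f : X → EReal) (μ : Measure X) : Prop :=
  Integrable (fun x => (f x).toReal) μ ∧ (∀ᵐ x ∂μ, f x ≠ ⊤ ∧ f x ≠ ⊥)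

/-- `∫ f dμ` for an a.e.-finite integrable field. -/
def fieldIntegral (f : X → EReal) (μ : Measure X) : ℝ := ∫ x, (f x).toReal ∂μ

/-- The Gauss functional `I_f(μ) := I(μ) + 2 ∫ f dμ`. -/
def gaussI (κ : X → X → ℝ≥0∞) (f : X → EReal) (μ : Measure X) : ℝ :=
  (energy κ μ).toReal + 2 * fieldIntegral f μ

/-- Membership in `Ĕ⁺_f(A)`. -/
def Admissible (κ : X → X → ℝ≥0∞) (A : Set X) (f : X → EReal) (μ : Measure X) : Prop :=
  memBreve κ A μ ∧ FieldIntegrable f μ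

/-- `w_f(A) := inf { I_f(μ) : μ ∈ Ĕ⁺_f(A) }` (with `inf ∅ = ⊤`). -/
def wf (κ : X → X → ℝ≥0∞) (A : Set X) (f : X → EReal) : EReal :=
  ⨅ (μ : Measure X) (_ : Admissible κ A f μ), ((gaussI κ f μ : ℝ) : EReal)

/-- `l` is a solution of the inner Gauss variational problem for `(A,f)`. -/
def IsSolution (κ : X → X → ℝ≥0∞) (A : Set X) (f : X → EReal) (l : Measure X) : Prop :=
  Admissible κ A f l ∧ ((gaussI κ f l : ℝ) : EReal) = wf κ A f

/-- The `f`-weighted potential `U_f^μ := U^μ + f`. -/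
def wPotential (κ : X → X → ℝ≥0∞) (f : X → EReal) (μ : Measure X) (x : X) : EReal :=
  (potential κ μ x : EReal) + f x

/-- `∫ U_f^μ dμ`, the weighted equilibrium constant of a solution. -/
def wConst (κ : X → X → ℝ≥0∞) (f : X → EReal) (μ : Measure X) : ℝ :=
  ∫ x, (wPotential κ f μ x).toReal ∂μ

/-- The cone `E⁺(A)` is closed in the strong metric. -/
def StrongClosedEplusOn (κ : X → X → ℝ≥0∞) (A : Set X) : Prop :=
  ∀ (μ : ℕ → Measure X) (μ₀ : Measure X),
    (∀ n, memEplus κ (μ n) ∧ Concentrated (μ n) A) →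
    memEplus κ μ₀ → StrongTendstoSeq κ μ μ₀ → Concentrated μ₀ A

/-- Frostman's (first) maximum principle. -/
def FrostmanMax (κ : X → X → ℝ≥0∞) : Prop :=
  ∀ μ : Measure X, memEplus κ μ →
    (∀ x : X, (∀ U : Set X, IsOpen U → x ∈ U → 0 < μ U) → potential κ μ x ≤ 1) →
    ∀ x : X, potential κ μ x ≤ 1

/-- The domination (second maximum) principle. -/
def DominationPrinciple (κ : X → X → ℝ≥0∞) : Prop :=
  ∀ μ ν : Measure X, memEplus κ μ → memEplus κ ν →
    (∀ᵐ x ∂μ, potential κ μ x ≤ potential κ ν x) →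
    ∀ x : X, potential κ μ x ≤ potential κ ν x

/-- `β` is the inner balayage of `ζ` onto `A`: `β ∈ E⁺(A)` and `U^β = U^ζ` n.e. on `A`. -/
def IsInnerBalayage (κ : X → X → ℝ≥0∞) (A : Set X) (ζ β : Measure X) : Prop :=
  memEplus κ β ∧ Concentrated β A ∧
    NearlyEverywhere κ A (fun x => potential κ β x = potential κ ζ x)

/-- `γ` is the inner capacitary measure of `A`: `γ ∈ E⁺(A)` and `U^γ = 1` n.e. on `A`. -/
def IsCapacitaryMeasure (κ : X → X → ℝ≥0∞) (A : Set X) (γ : Measure X) : Prop :=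
  memEplus κ γ ∧ Concentrated γ A ∧
    NearlyEverywhere κ A (fun x => potential κ γ x = 1)

/-- `A` is quasiclosed: approximable in outer capacity by closed sets. -/
def Quasiclosed (κ : X → X → ℝ≥0∞) (A : Set X) : Prop :=
  ∀ ε : ℝ≥0∞, 0 < ε → ∃ F : Set X, IsClosed F ∧ outerCap κ (symmDiff A F) < ε

/-- `A` is quasicompact: approximable in outer capacity by compact sets. -/
def Quasicompact (κ : X → X → ℝ≥0∞) (A : Set X) : Prop :=
  ∀ ε : ℝ≥0∞, 0 < ε → ∃ K : Set X, IsCompact K ∧ outerCap κ (symmDiff A K) < ε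

section RadonIntegration

open scoped NNReal

variable {Y : Type*} [TopologicalSpace Y] [MeasurableSpace Y]

/-- A Radon measure is `τ`-additive on directed families of open sets. -/
theorem measure_iUnion_of_directed_isOpen {ι : Type*} [Nonempty ι] (μ : Measure Y) [μ.Regular]
    {U : ι → Set Y} (hU : ∀ i, IsOpen (U i)) (hd : Directed (· ⊆ ·) U) :
    μ (⋃ i, U i) = ⨆ i, μ (U i) := by
  refine le_antisymm ?_ (iSup_le fun i => measure_mono (subset_iUnion U i))
  rw [(isOpen_iUnion hU).measure_eq_iSup_isCompact]
  refine iSup₂_le fun K hKU => iSup_le fun hK => ?_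
  obtain ⟨i, hi⟩ := hK.elim_directed_cover U hU hKU hd
  exact (measure_mono hi).trans (le_iSup (fun i => μ (U i)) i)

/-- Lower approximation of an extended nonnegative number by counting grid points below. -/
theorem le_liminf_grid (a : ℝ≥0∞) :
    a ≤ liminf (fun n : ℕ => ∑ k ∈ Finset.range (n ^ 2),
      ((n : ℝ≥0∞)⁻¹ * if ((k : ℝ≥0∞) + 1) / n < a then 1 else 0)) atTop := by
  refine le_of_forall_lt fun b hb => ?_
  obtain ⟨c, hbc, hca⟩ := ENNReal.lt_iff_exists_nnreal_btwn.1 hb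
  have hlim : Tendsto (fun n : ℕ => ((⌊(c : ℝ) * n⌋₊ : ℝ) / n)) atTop (𝓝 c) :=
    (tendsto_nat_floor_mul_div_atTop c.2).comp tendsto_natCast_atTop_atTop
  have hlim' := ENNReal.tendsto_ofReal hlim
  rw [ENNReal.ofReal_coe_nnreal] at hlim'
  refine hbc.trans_le (hlim'.liminf_eq.symm.le.trans (liminf_le_liminf ?_))
  obtain ⟨N, hN⟩ := exists_nat_ge (c : ℝ)
  filter_upwards [eventually_ge_atTop (max N 1)] with n hn
  have hn1 : 1 ≤ n := (le_max_right _ _).trans hn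
  have hn0 : (0 : ℝ) < n := by exact_mod_cast hn1
  have hcn : (c : ℝ) ≤ n := hN.trans (by exact_mod_cast (le_max_left _ _).trans hn)
  have hsub : Finset.range ⌊(c : ℝ) * n⌋₊ ⊆ Finset.range (n ^ 2) := by
    refine Finset.range_subset_range.2 ?_
    have : (c : ℝ) * n ≤ ((n ^ 2 : ℕ) : ℝ) := by push_cast; nlinarith
    exact (Nat.floor_le_floor this).trans (Nat.floor_natCast _).le
  refine le_trans ?_ (Finset.sum_le_sum_of_subset hsub)
  rw [Finset.sum_congr rfl (g := fun _ => (n : ℝ≥0∞)⁻¹)]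
  · rw [Finset.sum_const, Finset.card_range, nsmul_eq_mul, ENNReal.ofReal_div_of_pos hn0,
      ENNReal.ofReal_natCast, ENNReal.ofReal_natCast, div_eq_mul_inv]
  · intro k hk
    rw [if_pos, mul_one]
    refine lt_of_le_of_lt ?_ hca
    refine ENNReal.div_le_of_le_mul ?_
    have h1 : ((k + 1 : ℕ) : ℝ) ≤ (c : ℝ) * n :=
      (Nat.cast_le.2 (Nat.succ_le_of_lt (Finset.mem_range.1 hk))).trans
        (Nat.floor_le (by positivity))
    have h2 : ((k + 1 : ℕ) : ℝ≥0) ≤ c * n := by exact_mod_cast h1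
    exact_mod_cast h2

theorem grid_le (a : ℝ≥0∞) (n m : ℕ) :
    ∑ k ∈ Finset.range m, ((n : ℝ≥0∞)⁻¹ * if ((k : ℝ≥0∞) + 1) / n < a then 1 else 0) ≤ a := by
  have h : ∀ m : ℕ, ∑ k ∈ Finset.range m,
      ((n : ℝ≥0∞)⁻¹ * if ((k : ℝ≥0∞) + 1) / n < a then 1 else 0) ≤ min ((m : ℝ≥0∞) / n) a := by
    intro m
    induction m with
    | zero => simp
    | succ m ih =>
      rw [Finset.sum_range_succ]
      split_ifs with hm
      · have : ∑ k ∈ Finset.range m,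
            ((n : ℝ≥0∞)⁻¹ * if ((k : ℝ≥0∞) + 1) / n < a then 1 else 0) + (n : ℝ≥0∞)⁻¹ * 1
            ≤ ((m : ℝ≥0∞) + 1) / n := by
          rw [ENNReal.add_div, mul_one, one_div]
          gcongr
          exact ih.trans (min_le_left _ _)
        rw [Nat.cast_succ]
        exact le_min this (this.trans hm.le)
      · rw [mul_zero, add_zero]
        refine ih.trans (min_le_min_right _ ?_)
        gcongr
        simp
  exact (h m).trans (min_le_right _ _)

variable [OpensMeasurableSpace Y]

/-- The integral against a Radon measure commutes with suprema of directed families of lower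
semicontinuous functions. -/
theorem lintegral_iSup_of_directed_lowerSemicontinuous {ι : Type*} [Nonempty ι] (μ : Measure Y)
    [μ.Regular] {h : ι → Y → ℝ≥0∞} (hh : ∀ i, LowerSemicontinuous (h i))
    (hd : Directed (· ≤ ·) h) :
    ∫⁻ x, ⨆ i, h i x ∂μ = ⨆ i, ∫⁻ x, h i x ∂μ := by
  refine le_antisymm ?_ (iSup_le fun i => lintegral_mono fun x => le_iSup (fun i => h i x) i)
  have hopen : ∀ i (t : ℝ≥0∞), IsOpen {x | t < h i x} := fun i t => (hh i).isOpen_preimage t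
  have hsup : LowerSemicontinuous fun x => ⨆ i, h i x := lowerSemicontinuous_iSup hh
  have hsopen : ∀ t : ℝ≥0∞, IsOpen {x | t < ⨆ i, h i x} := fun t => hsup.isOpen_preimage t
  have hkey : ∀ t : ℝ≥0∞, μ {x | t < ⨆ i, h i x} = ⨆ i, μ {x | t < h i x} := by
    intro t
    rw [← measure_iUnion_of_directed_isOpen μ (fun i => hopen i t)]
    · congr 1; ext x; simp [lt_iSup_iff]
    · intro i j
      obtain ⟨k, hik, hjk⟩ := hd i j
      exact ⟨k, fun x hx => lt_of_lt_of_le hx (hik x), fun x hx => lt_of_lt_of_le hx (hjk x)⟩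
  have hint : ∀ (g : Y → ℝ≥0∞) (_ : ∀ t : ℝ≥0∞, IsOpen {x | t < g x}) (n : ℕ),
      ∫⁻ x, ∑ k ∈ Finset.range (n ^ 2),
        ((n : ℝ≥0∞)⁻¹ * if ((k : ℝ≥0∞) + 1) / n < g x then 1 else 0) ∂μ
      = ∑ k ∈ Finset.range (n ^ 2), (n : ℝ≥0∞)⁻¹ * μ {x | ((k : ℝ≥0∞) + 1) / n < g x} := by
    intro g hg n
    have hm : ∀ k : ℕ, Measurable fun x : Y =>
        (if ((k : ℝ≥0∞) + 1) / n < g x then 1 else 0 : ℝ≥0∞) := fun k =>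
      Measurable.ite (hg _).measurableSet measurable_const measurable_const
    rw [lintegral_finsetSum _ fun k _ => (hm k).const_mul _]
    refine Finset.sum_congr rfl fun k _ => ?_
    rw [lintegral_const_mul _ (hm k)]
    congr 1
    rw [← lintegral_indicator_one (hg _).measurableSet]
    refine lintegral_congr fun x => ?_
    simp [Set.indicator_apply]
  calc ∫⁻ x, ⨆ i, h i x ∂μ
      ≤ ∫⁻ x, liminf (fun n : ℕ => ∑ k ∈ Finset.range (n ^ 2),
        ((n : ℝ≥0∞)⁻¹ * if ((k : ℝ≥0∞) + 1) / n < ⨆ i, h i x then 1 else 0)) atTop ∂μ :=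
        lintegral_mono fun x => le_liminf_grid _
    _ ≤ liminf (fun n : ℕ => ∫⁻ x, ∑ k ∈ Finset.range (n ^ 2),
        ((n : ℝ≥0∞)⁻¹ * if ((k : ℝ≥0∞) + 1) / n < ⨆ i, h i x then 1 else 0) ∂μ) atTop := by
        refine lintegral_liminf_le fun n => Finset.measurable_sum _ fun k _ => ?_
        exact (Measurable.ite (hsopen _).measurableSet measurable_const
          measurable_const).const_mul _
    _ ≤ ⨆ i, ∫⁻ x, h i x ∂μ := by
        refine liminf_le_of_frequently_le' (Frequently.of_forall fun n => ?_)
        rw [hint _ hsopen]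
        simp_rw [hkey, ENNReal.mul_iSup]
        rw [ENNReal.finsetSum_iSup]
        · refine iSup_mono fun i => ?_
          rw [← hint _ (hopen i)]
          exact lintegral_mono fun x => grid_le _ _ _
        · intro i j
          obtain ⟨k, hik, hjk⟩ := hd i j
          exact ⟨k, fun a => ⟨by gcongr; exact hik _, by gcongr; exact hjk _⟩⟩

end RadonIntegration

section Minorants

open scoped NNReal

/-- The continuous compactly supported nonnegative functions lying below `k`. -/
def CcMinorant {Z : Type*} [TopologicalSpace Z] (k : Z → ℝ≥0∞) : Type _ :=
  {g : Z → ℝ≥0 // Continuous g ∧ HasCompactSupport g ∧ ∀ z, (g z : ℝ≥0∞) ≤ k z}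

instance {Z : Type*} [TopologicalSpace Z] (k : Z → ℝ≥0∞) : Nonempty (CcMinorant k) :=
  ⟨⟨fun _ => 0, continuous_const, HasCompactSupport.zero, fun _ => by simp⟩⟩

theorem CcMinorant.directed {Z : Type*} [TopologicalSpace Z] (k : Z → ℝ≥0∞) :
    Directed (· ≤ ·) (fun g : CcMinorant k => g.1) := by
  rintro ⟨g, hg, hgs, hgk⟩ ⟨h, hh, hhs, hhk⟩
  refine ⟨⟨g ⊔ h, hg.sup hh, hgs.sup hhs, fun z => ?_⟩, le_sup_left, le_sup_right⟩
  rw [Pi.sup_apply, ENNReal.coe_max]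
  exact max_le (hgk z) (hhk z)

theorem iSup_ccMinorant {Z : Type*} [TopologicalSpace Z] [T2Space Z] [LocallyCompactSpace Z]
    {k : Z → ℝ≥0∞} (hk : LowerSemicontinuous k) (z : Z) :
    ⨆ g : CcMinorant k, (g.1 z : ℝ≥0∞) = k z := by
  refine le_antisymm (iSup_le fun g => g.2.2.2 z) (le_of_forall_lt fun b hb => ?_)
  obtain ⟨c, hbc, hcz⟩ := ENNReal.lt_iff_exists_nnreal_btwn.1 hb
  obtain ⟨φ, h1, h0, hs, hI⟩ := exists_continuous_one_zero_of_isCompact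
    (isCompact_singleton (x := z)) (hk.isOpen_preimage (c : ℝ≥0∞)).isClosed_compl
    (by simpa using hcz)
  have hz : φ z = 1 := h1 rfl
  refine hbc.trans_le ?_
  refine le_iSup_of_le (⟨fun w => c * (φ w).toNNReal, by fun_prop, ?_, fun w => ?_⟩ :
    CcMinorant k) (by simp [hz])
  · exact (hs.comp_left (g := fun t : ℝ => c * t.toNNReal) (by simp))
  · by_cases hw : (c : ℝ≥0∞) < k w
    · refine le_trans ?_ hw.le
      have : (φ w).toNNReal ≤ 1 := Real.toNNReal_le_one.2 (hI w).2
      exact_mod_cast mul_le_of_le_one_right zero_le this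
    · have : φ w = 0 := h0 (by simpa using hw)
      simp [this]

variable {X : Type*} [TopologicalSpace X]

theorem hasCompactSupport_slice [T2Space X] {g : X × X → ℝ≥0} (hgs : HasCompactSupport g) (x : X) :
    HasCompactSupport fun y => (g (x, y) : ℝ) := by
  refine HasCompactSupport.intro (hgs.isCompact.image continuous_snd) fun y hy => ?_
  have : g (x, y) = 0 := by
    by_contra h
    exact hy ⟨(x, y), subset_tsupport _ h, rfl⟩
  simp [this]

variable [MeasurableSpace X]

theorem hasCompactSupport_integral_slice [T2Space X] {g : X × X → ℝ≥0} (hgs : HasCompactSupport g)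
    (ν : Measure X) : HasCompactSupport fun x => ∫ y, (g (x, y) : ℝ) ∂ν := by
  refine HasCompactSupport.intro (hgs.isCompact.image continuous_fst) fun x hx => ?_
  have : ∀ y, g (x, y) = 0 := fun y => by
    by_contra h
    exact hx ⟨(x, y), subset_tsupport _ h, rfl⟩
  simp [this]

variable [OpensMeasurableSpace X]

theorem continuous_integral_slice {g : X × X → ℝ≥0} (hg : Continuous g) (hgs : HasCompactSupport g)
    (ν : Measure X) [IsFiniteMeasureOnCompacts ν] :
    Continuous fun x => ∫ y, (g (x, y) : ℝ) ∂ν := by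
  rw [← continuousOn_univ]
  refine continuousOn_integral_of_compact_support (hgs.isCompact.image continuous_snd)
    (f := fun x y => (g (x, y) : ℝ)) (by fun_prop) fun x y _ hy => ?_
  have : g (x, y) = 0 := by
    by_contra h
    exact hy ⟨(x, y), subset_tsupport _ h, rfl⟩
  simp [this]

variable [T2Space X]

theorem lintegral_slice {g : X × X → ℝ≥0} (hg : Continuous g) (hgs : HasCompactSupport g)
    (ν : Measure X) [IsFiniteMeasureOnCompacts ν] (x : X) :
    ∫⁻ y, (g (x, y) : ℝ≥0∞) ∂ν = ENNReal.ofReal (∫ y, (g (x, y) : ℝ) ∂ν) :=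
  lintegral_coe_eq_integral _ (Continuous.integrable_of_hasCompactSupport (by fun_prop)
    (hasCompactSupport_slice hgs x))

theorem continuous_lintegral_slice {g : X × X → ℝ≥0} (hg : Continuous g)
    (hgs : HasCompactSupport g) (ν : Measure X) [IsFiniteMeasureOnCompacts ν] :
    Continuous fun x => ∫⁻ y, (g (x, y) : ℝ≥0∞) ∂ν := by
  simp_rw [lintegral_slice hg hgs ν]
  exact ENNReal.continuous_ofReal.comp (continuous_integral_slice hg hgs ν)

theorem lintegral_lintegral_slice {g : X × X → ℝ≥0} (hg : Continuous g)
    (hgs : HasCompactSupport g) (μ ν : Measure X) [IsFiniteMeasureOnCompacts μ]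
    [IsFiniteMeasureOnCompacts ν] :
    ∫⁻ x, ∫⁻ y, (g (x, y) : ℝ≥0∞) ∂ν ∂μ = ENNReal.ofReal (∫ x, ∫ y, (g (x, y) : ℝ) ∂ν ∂μ) := by
  simp_rw [lintegral_slice hg hgs ν]
  refine (ofReal_integral_eq_lintegral_ofReal ?_ ?_).symm
  · exact (continuous_integral_slice hg hgs ν).integrable_of_hasCompactSupport
      (hasCompactSupport_integral_slice hgs ν)
  · exact Eventually.of_forall fun x => integral_nonneg fun y => NNReal.coe_nonneg _

theorem lintegral_lintegral_slice_swap {g : X × X → ℝ≥0} (hg : Continuous g)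
    (hgs : HasCompactSupport g) (μ ν : Measure X) [IsFiniteMeasureOnCompacts μ]
    [IsFiniteMeasureOnCompacts ν] :
    ∫⁻ x, ∫⁻ y, (g (x, y) : ℝ≥0∞) ∂ν ∂μ = ∫⁻ y, ∫⁻ x, (g (x, y) : ℝ≥0∞) ∂μ ∂ν := by
  have hswap := lintegral_lintegral_slice (g := g ∘ Prod.swap) (hg.comp continuous_swap)
    (hgs.comp_homeomorph (Homeomorph.prodComm X X)) ν μ
  simp only [Function.comp_apply, Prod.swap_prod_mk] at hswap
  rw [lintegral_lintegral_slice hg hgs, hswap]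
  congr 1
  refine integral_integral_swap_of_hasCompactSupport (f := fun x y => (g (x, y) : ℝ)) ?_ ?_
  · exact NNReal.continuous_coe.comp hg
  · exact hgs.comp_left (g := fun t : ℝ≥0 => (t : ℝ)) rfl

end Minorants

section IteratedEnergy

open scoped NNReal

theorem regular_add {Y : Type*} [TopologicalSpace Y] [MeasurableSpace Y]
    [OpensMeasurableSpace Y] (μ ν : Measure Y) [μ.Regular] [ν.Regular] : (μ + ν).Regular := by
  refine { lt_top_of_isCompact := fun K hK => ?_, outerRegular := fun S hS r hr => ?_,
           innerRegular := fun U hU r hr => ?_ }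
  · rw [Measure.add_apply]
    exact ENNReal.add_lt_top.2 ⟨hK.measure_lt_top, hK.measure_lt_top⟩
  · rw [gt_iff_lt, Measure.add_apply] at hr
    obtain ⟨a, b, ha, hb, hab⟩ : ∃ a b, μ S < a ∧ ν S < b ∧ a + b ≤ r := by
      obtain ⟨s, hs, hsr⟩ := exists_between hr
      have hfin := ENNReal.add_ne_top.1 (hs.trans_le le_top).ne
      have hδ : (s - (μ S + ν S)) / 2 ≠ 0 := by
        simpa [ENNReal.div_eq_zero_iff, tsub_eq_zero_iff_le] using hs
      refine ⟨_, _, ENNReal.lt_add_right hfin.1 hδ, ENNReal.lt_add_right hfin.2 hδ, ?_⟩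
      rw [add_add_add_comm, ENNReal.add_halves, add_tsub_cancel_of_le hs.le]
      exact hsr.le
    obtain ⟨U, hSU, hU, hUa⟩ := S.exists_isOpen_lt_of_lt a ha
    obtain ⟨V, hSV, hV, hVb⟩ := S.exists_isOpen_lt_of_lt b hb
    refine ⟨U ∩ V, subset_inter hSU hSV, hU.inter hV, ?_⟩
    rw [Measure.add_apply]
    exact (ENNReal.add_lt_add ((measure_mono inter_subset_left).trans_lt hUa)
      ((measure_mono inter_subset_right).trans_lt hVb)).trans_le hab
  · by_contra! hcon
    refine hr.not_ge ?_
    rw [Measure.add_apply, hU.measure_eq_iSup_isCompact, hU.measure_eq_iSup_isCompact]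
    simp_rw [iSup_and']
    refine ENNReal.biSup_add_biSup_le' ⟨∅, empty_subset _, isCompact_empty⟩
      ⟨∅, empty_subset _, isCompact_empty⟩ fun K hK L hL => ?_
    refine le_trans ?_ (hcon (K ∪ L) (union_subset hK.1 hL.1) (hK.2.union hL.2))
    rw [Measure.add_apply]
    gcongr
    · exact subset_union_left
    · exact subset_union_right

/-- The mutual energy as an iterated integral `∫ U^ν dμ`. -/
def iterEnergy {X : Type*} [MeasurableSpace X] (κ : X → X → ℝ≥0∞) (μ ν : Measure X) : ℝ≥0∞ :=
  ∫⁻ x, potential κ ν x ∂μ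

theorem mutualEnergy_le_iterEnergy {X : Type*} [MeasurableSpace X] (κ : X → X → ℝ≥0∞)
    (μ ν : Measure X) : mutualEnergy κ μ ν ≤ iterEnergy κ μ ν :=
  lintegral_prod_le _

theorem iterEnergy_add_left {X : Type*} [MeasurableSpace X] (κ : X → X → ℝ≥0∞)
    (μ μ' ν : Measure X) : iterEnergy κ (μ + μ') ν = iterEnergy κ μ ν + iterEnergy κ μ' ν :=
  lintegral_add_measure _ _ _

theorem iterEnergy_smul_left {X : Type*} [MeasurableSpace X] (κ : X → X → ℝ≥0∞)
    (c : ℝ≥0) (μ ν : Measure X) : iterEnergy κ (c • μ) ν = c * iterEnergy κ μ ν := by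
  rw [iterEnergy, lintegral_smul_measure, ENNReal.smul_def, smul_eq_mul, iterEnergy]

theorem iterEnergy_smul_right {X : Type*} [MeasurableSpace X] (κ : X → X → ℝ≥0∞)
    (c : ℝ≥0) (μ ν : Measure X) : iterEnergy κ μ (c • ν) = c * iterEnergy κ μ ν := by
  unfold iterEnergy
  rw [← lintegral_const_mul' _ _ ENNReal.coe_ne_top]
  refine lintegral_congr fun x => ?_
  rw [potential, lintegral_smul_measure, ENNReal.smul_def, smul_eq_mul, potential]

variable {X : Type*} [TopologicalSpace X] [T2Space X] [LocallyCompactSpace X] {κ : X → X → ℝ≥0∞}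

theorem kernel_eq_iSup (hker : IsKernel κ) (x y : X) :
    κ x y = ⨆ g : CcMinorant (fun p : X × X => κ p.1 p.2), (g.1 (x, y) : ℝ≥0∞) :=
  (iSup_ccMinorant hker.2 (x, y)).symm

variable [MeasurableSpace X] [BorelSpace X]

theorem potential_eq_iSup (hker : IsKernel κ) (ν : Measure X) [ν.Regular] (x : X) :
    potential κ ν x =
      ⨆ g : CcMinorant (fun p : X × X => κ p.1 p.2), ∫⁻ y, (g.1 (x, y) : ℝ≥0∞) ∂ν := by
  unfold potential
  simp_rw [kernel_eq_iSup hker]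
  refine lintegral_iSup_of_directed_lowerSemicontinuous ν (fun g => ?_) fun g h => ?_
  · have := g.2.1
    exact Continuous.lowerSemicontinuous (by fun_prop)
  · obtain ⟨k, hk1, hk2⟩ := CcMinorant.directed _ g h
    exact ⟨k, fun y => by simpa using hk1 (x, y), fun y => by simpa using hk2 (x, y)⟩

theorem lowerSemicontinuous_potential (hker : IsKernel κ) (ν : Measure X) [ν.Regular] :
    LowerSemicontinuous (potential κ ν) := by
  rw [funext (potential_eq_iSup hker ν)]
  exact lowerSemicontinuous_iSup fun g =>
    (continuous_lintegral_slice g.2.1 g.2.2.1 ν).lowerSemicontinuous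

theorem iterEnergy_eq_iSup (hker : IsKernel κ) (μ ν : Measure X) [μ.Regular] [ν.Regular] :
    iterEnergy κ μ ν = ⨆ g : CcMinorant (fun p : X × X => κ p.1 p.2),
      ∫⁻ x, ∫⁻ y, (g.1 (x, y) : ℝ≥0∞) ∂ν ∂μ := by
  unfold iterEnergy
  simp_rw [potential_eq_iSup hker]
  refine lintegral_iSup_of_directed_lowerSemicontinuous μ (fun g =>
    (continuous_lintegral_slice g.2.1 g.2.2.1 ν).lowerSemicontinuous) fun g h => ?_
  obtain ⟨k, hk1, hk2⟩ := CcMinorant.directed _ g h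
  exact ⟨k, fun x => lintegral_mono fun y => by simpa using hk1 (x, y),
    fun x => lintegral_mono fun y => by simpa using hk2 (x, y)⟩

theorem iterEnergy_comm (hker : IsKernel κ) (μ ν : Measure X) [μ.Regular] [ν.Regular] :
    iterEnergy κ μ ν = iterEnergy κ ν μ := by
  have h : ∀ (μ ν : Measure X) [μ.Regular] [ν.Regular], iterEnergy κ μ ν ≤ iterEnergy κ ν μ := by
    intro μ ν _ _
    rw [iterEnergy_eq_iSup hker]
    refine iSup_le fun g => ?_
    rw [lintegral_lintegral_slice_swap g.2.1 g.2.2.1]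
    refine lintegral_mono fun y => lintegral_mono fun x => ?_
    rw [hker.1 y x]
    exact g.2.2.2 (x, y)
  exact le_antisymm (h μ ν) (h ν μ)

theorem iterEnergy_add_right (hker : IsKernel κ) (μ ν ν' : Measure X) [ν.Regular] :
    iterEnergy κ μ (ν + ν') = iterEnergy κ μ ν + iterEnergy κ μ ν' := by
  unfold iterEnergy
  rw [← lintegral_add_left (lowerSemicontinuous_potential hker ν).measurable]
  exact lintegral_congr fun x => lintegral_add_measure _ _ _

/-- As soon as `Measure.prod` is not degenerate, the mutual energy of Radon measures is the
iterated integral, although `κ` need not be measurable for the product `σ`-algebra. -/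
theorem mutualEnergy_eq_iterEnergy_of_aemeasurable (hker : IsKernel κ) (μ ν : Measure X)
    [μ.Regular] [ν.Regular] (hm : AEMeasurable (fun x : X => ν.map (Prod.mk x)) μ) :
    mutualEnergy κ μ ν = iterEnergy κ μ ν := by
  refine le_antisymm (mutualEnergy_le_iterEnergy κ μ ν) ?_
  rw [iterEnergy_eq_iSup hker]
  refine iSup_le fun g => ?_
  have hgm : Measurable fun p : X × X => (g.1 p : ℝ≥0∞) :=
    (g.2.2.1.stronglyMeasurable_of_prod g.2.1).measurable.coe_nnreal_ennreal
  calc ∫⁻ x, ∫⁻ y, (g.1 (x, y) : ℝ≥0∞) ∂ν ∂μ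
      = ∫⁻ p, (g.1 p : ℝ≥0∞) ∂(μ.prod ν) := by
        rw [Measure.prod, Measure.lintegral_bind hm hgm.aemeasurable]
        refine lintegral_congr fun x => ?_
        rw [lintegral_map hgm measurable_prodMk_left]
    _ ≤ mutualEnergy κ μ ν := lintegral_mono fun p => g.2.2.2 p

theorem mutualEnergy_eq_iterEnergy (hker : IsKernel κ) (μ ν : Measure X)
    [μ.Regular] [ν.Regular] [SFinite ν] : mutualEnergy κ μ ν = iterEnergy κ μ ν :=
  mutualEnergy_eq_iterEnergy_of_aemeasurable hker μ ν Measurable.map_prodMk_left.aemeasurable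

theorem energy_eq_iterEnergy (hker : IsKernel κ) (hep : EnergyPrinciple κ) {μ : Measure X}
    (hμ : memEplus κ μ) : energy κ μ = iterEnergy κ μ μ := by
  have : μ.Regular := hμ.1
  by_cases hm : AEMeasurable (fun x : X => μ.map (Prod.mk x)) μ
  · exact mutualEnergy_eq_iterEnergy_of_aemeasurable hker μ μ hm
  · have h0 : μ.prod μ = 0 := by
      rw [Measure.prod, Measure.bind, Measure.map_of_not_aemeasurable hm, Measure.join_zero]
    have he : energy κ μ = 0 := by simp [energy, mutualEnergy, h0]
    have hz : memEplus κ (0 : Measure X) :=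
      ⟨inferInstanceAs (Measure.Regular (0 : Measure X)), by simp [energy, mutualEnergy]⟩
    have : μ = 0 := (hep μ 0 hμ hz).2 (by rw [he]; simp [energy, mutualEnergy])
    exact absurd (this ▸ aemeasurable_zero_measure) hm

theorem memEplus_iff (hker : IsKernel κ) (hep : EnergyPrinciple κ) (μ : Measure X) :
    memEplus κ μ ↔ μ.Regular ∧ iterEnergy κ μ μ < ⊤ :=
  ⟨fun h => ⟨h.1, energy_eq_iterEnergy hker hep h ▸ h.2⟩,
    fun h => ⟨h.1, (mutualEnergy_le_iterEnergy κ μ μ).trans_lt h.2⟩⟩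

end IteratedEnergy

section RealForm

open scoped NNReal

/-- The mutual energy as a real number. -/
def form {X : Type*} [MeasurableSpace X] (κ : X → X → ℝ≥0∞) (μ ν : Measure X) : ℝ :=
  (iterEnergy κ μ ν).toReal

theorem form_nonneg {X : Type*} [MeasurableSpace X] (κ : X → X → ℝ≥0∞) (μ ν : Measure X) :
    0 ≤ form κ μ ν := ENNReal.toReal_nonneg

theorem form_smul_left {X : Type*} [MeasurableSpace X] (κ : X → X → ℝ≥0∞)
    (c : ℝ≥0) (μ ν : Measure X) : form κ (c • μ) ν = c * form κ μ ν := by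
  simp [form, iterEnergy_smul_left]

theorem form_smul_right {X : Type*} [MeasurableSpace X] (κ : X → X → ℝ≥0∞)
    (c : ℝ≥0) (μ ν : Measure X) : form κ μ (c • ν) = c * form κ μ ν := by
  simp [form, iterEnergy_smul_right]

variable {X : Type*} [TopologicalSpace X] [T2Space X] [LocallyCompactSpace X]
  [MeasurableSpace X] [BorelSpace X] {κ : X → X → ℝ≥0∞}

theorem form_comm (hker : IsKernel κ) {μ ν : Measure X} (hμ : memEplus κ μ) (hν : memEplus κ ν) :
    form κ μ ν = form κ ν μ := by
  have : μ.Regular := hμ.1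
  have : ν.Regular := hν.1
  rw [form, iterEnergy_comm hker, form]

theorem iterEnergy_add_self (hker : IsKernel κ) {μ ν : Measure X} (hμ : memEplus κ μ)
    (hν : memEplus κ ν) :
    iterEnergy κ (μ + ν) (μ + ν) =
      iterEnergy κ μ μ + 2 * iterEnergy κ μ ν + iterEnergy κ ν ν := by
  have : μ.Regular := hμ.1
  have : ν.Regular := hν.1
  rw [iterEnergy_add_left, iterEnergy_add_right hker, iterEnergy_add_right hker,
    iterEnergy_comm hker ν μ]
  ring

theorem toReal_energy (hker : IsKernel κ) (hep : EnergyPrinciple κ)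
    {μ : Measure X} (hμ : memEplus κ μ) : (energy κ μ).toReal = form κ μ μ := by
  rw [energy_eq_iterEnergy hker hep hμ, form]

theorem iterEnergy_self_ne_top (hker : IsKernel κ) (hep : EnergyPrinciple κ)
    {μ : Measure X} (hμ : memEplus κ μ) : iterEnergy κ μ μ ≠ ⊤ :=
  ((memEplus_iff hker hep μ).1 hμ).2.ne

theorem two_mul_iterEnergy_le (hker : IsKernel κ) (hep : EnergyPrinciple κ)
    {μ ν : Measure X} (hμ : memEplus κ μ) (hν : memEplus κ ν)
    [IsFiniteMeasure ν] :
    2 * iterEnergy κ μ ν ≤ iterEnergy κ μ μ + iterEnergy κ ν ν := by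
  have : μ.Regular := hμ.1
  have : ν.Regular := hν.1
  rw [← mutualEnergy_eq_iterEnergy hker, ← energy_eq_iterEnergy hker hep hμ,
    ← energy_eq_iterEnergy hker hep hν]
  exact (hep μ ν hμ hν).1

theorem iterEnergy_ne_top (hker : IsKernel κ) (hep : EnergyPrinciple κ)
    {μ ν : Measure X} (hμ : memEplus κ μ) (hν : memEplus κ ν)
    [IsFiniteMeasure ν] : iterEnergy κ μ ν ≠ ⊤ := by
  intro h
  have := two_mul_iterEnergy_le hker hep hμ hν
  rw [h, ENNReal.mul_top two_ne_zero, top_le_iff] at this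
  exact ENNReal.add_ne_top.2
    ⟨iterEnergy_self_ne_top hker hep hμ, iterEnergy_self_ne_top hker hep hν⟩ this

theorem two_mul_form_le (hker : IsKernel κ) (hep : EnergyPrinciple κ)
    {μ ν : Measure X} (hμ : memEplus κ μ) (hν : memEplus κ ν)
    [IsFiniteMeasure ν] : 2 * form κ μ ν ≤ form κ μ μ + form κ ν ν := by
  have h1 := iterEnergy_self_ne_top hker hep hμ
  have h2 := iterEnergy_self_ne_top hker hep hν
  have := ENNReal.toReal_mono (ENNReal.add_ne_top.2 ⟨h1, h2⟩)
    (two_mul_iterEnergy_le hker hep hμ hν)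
  rwa [ENNReal.toReal_add h1 h2, ENNReal.toReal_mul, ENNReal.toReal_ofNat] at this

theorem eq_of_two_mul_form_ge (hker : IsKernel κ) (hep : EnergyPrinciple κ)
    {μ ν : Measure X} (hμ : memEplus κ μ) (hν : memEplus κ ν)
    [IsFiniteMeasure ν] (h : form κ μ μ + form κ ν ν ≤ 2 * form κ μ ν) : μ = ν := by
  have : μ.Regular := hμ.1
  have : ν.Regular := hν.1
  have h1 := iterEnergy_self_ne_top hker hep hμ
  have h2 := iterEnergy_self_ne_top hker hep hν
  refine (hep μ ν hμ hν).2 ?_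
  rw [mutualEnergy_eq_iterEnergy hker, energy_eq_iterEnergy hker hep hμ,
    energy_eq_iterEnergy hker hep hν]
  refine (ENNReal.toReal_eq_toReal_iff'
    (ENNReal.mul_ne_top ENNReal.ofNat_ne_top (iterEnergy_ne_top hker hep hμ hν))
    (ENNReal.add_ne_top.2 ⟨h1, h2⟩)).1 ?_
  rw [ENNReal.toReal_add h1 h2, ENNReal.toReal_mul, ENNReal.toReal_ofNat]
  exact le_antisymm (two_mul_form_le hker hep hμ hν) h

theorem memEplus_add (hker : IsKernel κ) (hep : EnergyPrinciple κ)
    {μ ν : Measure X} (hμ : memEplus κ μ) (hν : memEplus κ ν)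
    [IsFiniteMeasure ν] : memEplus κ (μ + ν) := by
  have : μ.Regular := hμ.1
  have : ν.Regular := hν.1
  refine (memEplus_iff hker hep _).2 ⟨regular_add μ ν, ?_⟩
  rw [iterEnergy_add_self hker hμ hν, lt_top_iff_ne_top]
  have := iterEnergy_self_ne_top hker hep hμ
  have := iterEnergy_self_ne_top hker hep hν
  have := iterEnergy_ne_top hker hep hμ hν
  finiteness

theorem memEplus_smul (hker : IsKernel κ) (hep : EnergyPrinciple κ)
    {μ : Measure X} (hμ : memEplus κ μ) (c : ℝ≥0) : memEplus κ (c • μ) := by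
  have : μ.Regular := hμ.1
  refine (memEplus_iff hker hep _).2 ⟨inferInstance, ?_⟩
  rw [iterEnergy_smul_left, iterEnergy_smul_right, lt_top_iff_ne_top]
  have := iterEnergy_self_ne_top hker hep hμ
  finiteness

theorem form_add_self (hker : IsKernel κ) (hep : EnergyPrinciple κ)
    {μ ν : Measure X} (hμ : memEplus κ μ) (hν : memEplus κ ν)
    [IsFiniteMeasure ν] :
    form κ (μ + ν) (μ + ν) = form κ μ μ + 2 * form κ μ ν + form κ ν ν := by
  have h1 := iterEnergy_self_ne_top hker hep hμ
  have h2 := iterEnergy_self_ne_top hker hep hν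
  have h3 := iterEnergy_ne_top hker hep hμ hν
  rw [form, iterEnergy_add_self hker hμ hν, ENNReal.toReal_add (by finiteness) h2,
    ENNReal.toReal_add h1 (by finiteness), ENNReal.toReal_mul, ENNReal.toReal_ofNat]
  rfl

theorem form_add_left (hker : IsKernel κ) (hep : EnergyPrinciple κ)
    {μ μ' ν : Measure X} (hμ : memEplus κ μ) (hμ' : memEplus κ μ')
    (hν : memEplus κ ν) [IsFiniteMeasure ν] :
    form κ (μ + μ') ν = form κ μ ν + form κ μ' ν := by
  rw [form, iterEnergy_add_left, ENNReal.toReal_add (iterEnergy_ne_top hker hep hμ hν)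
    (iterEnergy_ne_top hker hep hμ' hν)]
  rfl

theorem form_add_right (hker : IsKernel κ) (hep : EnergyPrinciple κ)
    {μ ν ν' : Measure X} (hμ : memEplus κ μ) (hν : memEplus κ ν)
    (hν' : memEplus κ ν') [IsFiniteMeasure ν] [IsFiniteMeasure ν'] :
    form κ μ (ν + ν') = form κ μ ν + form κ μ ν' := by
  have : ν.Regular := hν.1
  rw [form, iterEnergy_add_right hker, ENNReal.toReal_add (iterEnergy_ne_top hker hep hμ hν)
    (iterEnergy_ne_top hker hep hμ hν')]
  rfl

theorem strongDist_sq (hker : IsKernel κ) (hep : EnergyPrinciple κ)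
    {μ ν : Measure X} (hμ : memEplus κ μ) (hν : memEplus κ ν)
    [IsFiniteMeasure ν] :
    strongDist κ μ ν ^ 2 = form κ μ μ + form κ ν ν - 2 * form κ μ ν := by
  have : μ.Regular := hμ.1
  have : ν.Regular := hν.1
  have hle := two_mul_form_le hker hep hμ hν
  rw [strongDist, toReal_energy hker hep hμ, toReal_energy hker hep hν,
    mutualEnergy_eq_iterEnergy hker, ← form, Real.sq_sqrt (by linarith)]

theorem strongDist_comm (hker : IsKernel κ) (hep : EnergyPrinciple κ)
    {μ ν : Measure X} (hμ : memEplus κ μ) (hν : memEplus κ ν)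
    [IsFiniteMeasure μ] [IsFiniteMeasure ν] : strongDist κ μ ν = strongDist κ ν μ := by
  refine (sq_eq_sq₀ (a := strongDist κ μ ν) (b := strongDist κ ν μ)
    (Real.sqrt_nonneg _) (Real.sqrt_nonneg _)).1 ?_
  rw [strongDist_sq hker hep hμ hν, strongDist_sq hker hep hν hμ, form_comm hker hμ hν]
  ring

theorem form_sub_form_le (hker : IsKernel κ) (hep : EnergyPrinciple κ)
    {ϑ μ ν : Measure X} (hϑ : memEplus κ ϑ) (hμ : memEplus κ μ)
    (hν : memEplus κ ν) [IsFiniteMeasure μ] [IsFiniteMeasure ν] :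
    form κ ϑ ν - form κ ϑ μ ≤ strongDist κ μ ν * (form κ ϑ ϑ + 1) := by
  have hd : 0 ≤ strongDist κ μ ν := Real.sqrt_nonneg _
  have he := form_nonneg κ ϑ ϑ
  have key : ∀ t : ℝ≥0, 2 * t * (form κ ϑ ν - form κ ϑ μ) ≤
      t ^ 2 * form κ ϑ ϑ + strongDist κ μ ν ^ 2 := by
    intro t
    have hϑt := memEplus_smul hker hep hϑ t
    have h := two_mul_form_le hker hep (memEplus_add hker hep hϑt hμ) hν
    rw [form_add_self hker hep hϑt hμ, form_add_left hker hep hϑt hμ hν, form_smul_left,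
      form_smul_left, form_smul_left, form_smul_right] at h
    rw [strongDist_sq hker hep hμ hν]
    linarith
  refine le_of_forall_pos_le_add fun ε hε => ?_
  set d := strongDist κ μ ν with hdd
  set e := form κ ϑ ϑ with hee
  obtain ⟨δ, hδ, hδε⟩ : ∃ δ > 0, δ * e ≤ ε :=
    ⟨ε / (e + 1), by positivity, by
      rw [div_mul_eq_mul_div, div_le_iff₀ (by positivity)]; nlinarith⟩
  have h : 2 * (d + δ) * (form κ ϑ ν - form κ ϑ μ) ≤ (d + δ) ^ 2 * e + d ^ 2 :=
    key ⟨d + δ, by positivity⟩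
  have hpos : 0 < d + δ := by positivity
  have : (d + δ) * (2 * (form κ ϑ ν - form κ ϑ μ)) ≤ (d + δ) * ((d + δ) * e + d) := by
    nlinarith
  have := le_of_mul_le_mul_left this hpos
  nlinarith

theorem abs_form_sub_form_le (hker : IsKernel κ) (hep : EnergyPrinciple κ)
    {ϑ μ ν : Measure X} (hϑ : memEplus κ ϑ) (hμ : memEplus κ μ)
    (hν : memEplus κ ν) [IsFiniteMeasure μ] [IsFiniteMeasure ν] :
    |form κ ϑ μ - form κ ϑ ν| ≤ strongDist κ μ ν * (form κ ϑ ϑ + 1) := by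
  refine abs_le.2 ⟨?_, ?_⟩
  · linarith [form_sub_form_le hker hep hϑ hμ hν]
  · rw [strongDist_comm hker hep hμ hν]
    exact form_sub_form_le hker hep hϑ hν hμ

theorem tendsto_form_of_strongDist (hker : IsKernel κ) (hep : EnergyPrinciple κ)
    {ι : Type*} {F : Filter ι} {μ : ι → Measure X} {ν ϑ : Measure X}
    (hϑ : memEplus κ ϑ) (hν : memEplus κ ν) [IsFiniteMeasure ν]
    (hμ : ∀ᶠ i in F, memEplus κ (μ i) ∧ IsFiniteMeasure (μ i))
    (h : Tendsto (fun i => strongDist κ (μ i) ν) F (𝓝 0)) :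
    Tendsto (fun i => form κ ϑ (μ i)) F (𝓝 (form κ ϑ ν)) := by
  rw [tendsto_iff_dist_tendsto_zero]
  have h' := h.mul_const (form κ ϑ ϑ + 1)
  rw [zero_mul] at h'
  refine squeeze_zero' (Eventually.of_forall fun _ => dist_nonneg) ?_ h'
  filter_upwards [hμ] with i hi
  have := hi.2
  exact abs_form_sub_form_le hker hep hϑ hi.1 hν

theorem tendsto_form_self_of_strongDist (hker : IsKernel κ) (hep : EnergyPrinciple κ)
    {ι : Type*} {F : Filter ι} {μ : ι → Measure X}
    {ν : Measure X} (hν : memEplus κ ν) [IsFiniteMeasure ν]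
    (hμ : ∀ᶠ i in F, memEplus κ (μ i) ∧ IsFiniteMeasure (μ i))
    (h : Tendsto (fun i => strongDist κ (μ i) ν) F (𝓝 0)) :
    Tendsto (fun i => form κ (μ i) (μ i)) F (𝓝 (form κ ν ν)) := by
  have h1 := tendsto_form_of_strongDist hker hep hν hν hμ h
  have h2 := ((h.pow 2).add (h1.const_mul 2)).sub_const (form κ ν ν)
  have h3 : (0 : ℝ) ^ 2 + 2 * form κ ν ν - form κ ν ν = form κ ν ν := by ring
  rw [h3] at h2
  refine h2.congr' ?_
  filter_upwards [hμ] with i hi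
  rw [strongDist_sq hker hep hi.1 hν, form_comm hker hi.1 hν]
  ring

end RealForm

section Admissible

variable {X : Type*} [TopologicalSpace X] [MeasurableSpace X] {κ : X → X → ℝ≥0∞} {A : Set X}

theorem memBreve.isFiniteMeasure {μ : Measure X} (h : memBreve κ A μ) : IsFiniteMeasure μ :=
  ⟨by rw [h.2.2]; exact one_lt_top⟩

theorem memBreve.mono {B : Set X} (hAB : A ⊆ B) {μ : Measure X} (h : memBreve κ A μ) :
    memBreve κ B μ :=
  ⟨h.1, fun K hK => measure_mono_null
    (inter_subset_inter_left _ (compl_subset_compl.2 hAB)) (h.2.1 K hK), h.2.2⟩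

theorem isSolution_iff {f : X → EReal} {l : Measure X} :
    IsSolution κ A f l ↔
      Admissible κ A f l ∧ ∀ μ, Admissible κ A f μ → gaussI κ f l ≤ gaussI κ f μ := by
  refine and_congr_right fun hl => ⟨fun h μ hμ => ?_, fun h => le_antisymm ?_ ?_⟩
  · rw [← EReal.coe_le_coe_iff, h]
    exact iInf₂_le μ hμ
  · exact le_iInf₂ fun μ hμ => EReal.coe_le_coe_iff.2 (h μ hμ)
  · exact iInf₂_le l hl

end Admissible

section GaussFunctional

open scoped NNReal

variable {X : Type*} [TopologicalSpace X] [T2Space X] [LocallyCompactSpace X]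
  [MeasurableSpace X] [BorelSpace X] {κ : X → X → ℝ≥0∞}

section Field

variable {μ ϑ : Measure X} [IsFiniteMeasure μ]

theorem lintegral_potential_ne_top (hker : IsKernel κ) (hep : EnergyPrinciple κ)
    (hϑ : memEplus κ ϑ) (hμ : memEplus κ μ) : ∫⁻ x, potential κ ϑ x ∂μ ≠ ⊤ := by
  have : μ.Regular := hμ.1
  have : ϑ.Regular := hϑ.1
  have h := iterEnergy_ne_top hker hep hϑ hμ
  rwa [iterEnergy_comm hker] at h

theorem measurable_potential (hker : IsKernel κ) (hϑ : memEplus κ ϑ) :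
    Measurable (potential κ ϑ) := by
  have : ϑ.Regular := hϑ.1
  exact (lowerSemicontinuous_potential hker ϑ).measurable

theorem ae_potential_lt_top (hker : IsKernel κ) (hep : EnergyPrinciple κ)
    (hϑ : memEplus κ ϑ) (hμ : memEplus κ μ) : ∀ᵐ x ∂μ, potential κ ϑ x < ⊤ :=
  ae_lt_top (measurable_potential hker hϑ) (lintegral_potential_ne_top hker hep hϑ hμ)

theorem integrable_toReal_potential (hker : IsKernel κ) (hep : EnergyPrinciple κ)
    (hϑ : memEplus κ ϑ) (hμ : memEplus κ μ) :
    Integrable (fun x => (potential κ ϑ x).toReal) μ :=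
  integrable_toReal_of_lintegral_ne_top (measurable_potential hker hϑ).aemeasurable
    (lintegral_potential_ne_top hker hep hϑ hμ)

theorem integral_toReal_potential (hker : IsKernel κ) (hep : EnergyPrinciple κ)
    (hϑ : memEplus κ ϑ) (hμ : memEplus κ μ) :
    ∫ x, (potential κ ϑ x).toReal ∂μ = form κ ϑ μ := by
  have : μ.Regular := hμ.1
  have : ϑ.Regular := hϑ.1
  rw [integral_toReal (measurable_potential hker hϑ).aemeasurable
    (ae_potential_lt_top hker hep hϑ hμ), form, iterEnergy_comm hker, iterEnergy]

end Field

variable {f : X → EReal} {ϑp ϑm : Measure X}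

theorem ae_field_ne_top_and_ne_bot (hker : IsKernel κ) (hep : EnergyPrinciple κ)
    (hp : memEplus κ ϑp) (hm : memEplus κ ϑm)
    (hf : ∀ x, f x = (potential κ ϑp x : EReal) - (potential κ ϑm x : EReal))
    {μ : Measure X} [IsFiniteMeasure μ] (hμ : memEplus κ μ) :
    ∀ᵐ x ∂μ, f x ≠ ⊤ ∧ f x ≠ ⊥ := by
  filter_upwards [ae_potential_lt_top hker hep hp hμ, ae_potential_lt_top hker hep hm hμ]
    with x h1 h2
  rw [hf]
  lift potential κ ϑp x to ℝ≥0 using h1.ne with a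
  lift potential κ ϑm x to ℝ≥0 using h2.ne with b
  exact ⟨EReal.coe_ne_top ((a : ℝ) - b), EReal.coe_ne_bot ((a : ℝ) - b)⟩

theorem toReal_field_ae_eq (hker : IsKernel κ) (hep : EnergyPrinciple κ)
    (hp : memEplus κ ϑp) (hm : memEplus κ ϑm)
    (hf : ∀ x, f x = (potential κ ϑp x : EReal) - (potential κ ϑm x : EReal))
    {μ : Measure X} [IsFiniteMeasure μ] (hμ : memEplus κ μ) :
    (fun x => (f x).toReal) =ᵐ[μ]
      fun x => (potential κ ϑp x).toReal - (potential κ ϑm x).toReal := by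
  filter_upwards [ae_potential_lt_top hker hep hp hμ, ae_potential_lt_top hker hep hm hμ]
    with x h1 h2
  rw [hf]
  lift potential κ ϑp x to ℝ≥0 using h1.ne with a
  lift potential κ ϑm x to ℝ≥0 using h2.ne with b
  exact EReal.toReal_coe ((a : ℝ) - b)

theorem fieldIntegrable_of_memEplus (hker : IsKernel κ) (hep : EnergyPrinciple κ)
    (hp : memEplus κ ϑp) (hm : memEplus κ ϑm)
    (hf : ∀ x, f x = (potential κ ϑp x : EReal) - (potential κ ϑm x : EReal))
    {μ : Measure X} [IsFiniteMeasure μ] (hμ : memEplus κ μ) : FieldIntegrable f μ :=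
  ⟨((integrable_toReal_potential hker hep hp hμ).sub
    (integrable_toReal_potential hker hep hm hμ)).congr
      (toReal_field_ae_eq hker hep hp hm hf hμ).symm,
    ae_field_ne_top_and_ne_bot hker hep hp hm hf hμ⟩

theorem fieldIntegral_eq (hker : IsKernel κ) (hep : EnergyPrinciple κ)
    (hp : memEplus κ ϑp) (hm : memEplus κ ϑm)
    (hf : ∀ x, f x = (potential κ ϑp x : EReal) - (potential κ ϑm x : EReal))
    {μ : Measure X} [IsFiniteMeasure μ] (hμ : memEplus κ μ) :
    fieldIntegral f μ = form κ ϑp μ - form κ ϑm μ := by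
  rw [fieldIntegral, integral_congr_ae (toReal_field_ae_eq hker hep hp hm hf hμ),
    integral_sub (integrable_toReal_potential hker hep hp hμ)
      (integrable_toReal_potential hker hep hm hμ),
    integral_toReal_potential hker hep hp hμ, integral_toReal_potential hker hep hm hμ]

theorem gaussI_eq (hker : IsKernel κ) (hep : EnergyPrinciple κ)
    (hp : memEplus κ ϑp) (hm : memEplus κ ϑm)
    (hf : ∀ x, f x = (potential κ ϑp x : EReal) - (potential κ ϑm x : EReal))
    {μ : Measure X} [IsFiniteMeasure μ] (hμ : memEplus κ μ) :
    gaussI κ f μ = form κ μ μ + 2 * (form κ ϑp μ - form κ ϑm μ) := by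
  rw [gaussI, toReal_energy hker hep hμ, fieldIntegral_eq hker hep hp hm hf hμ]

theorem wConst_eq (hker : IsKernel κ) (hep : EnergyPrinciple κ)
    (hp : memEplus κ ϑp) (hm : memEplus κ ϑm)
    (hf : ∀ x, f x = (potential κ ϑp x : EReal) - (potential κ ϑm x : EReal))
    {μ : Measure X} [IsFiniteMeasure μ] (hμ : memEplus κ μ) :
    wConst κ f μ = form κ μ μ + (form κ ϑp μ - form κ ϑm μ) := by
  have h := fieldIntegrable_of_memEplus hker hep hp hm hf hμ
  rw [← fieldIntegral_eq hker hep hp hm hf hμ, ← integral_toReal_potential hker hep hμ hμ,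
    fieldIntegral, ← integral_add (integrable_toReal_potential hker hep hμ hμ) h.1, wConst]
  refine integral_congr_ae ?_
  filter_upwards [ae_potential_lt_top hker hep hμ hμ, h.2] with x h1 h2
  rw [wPotential, EReal.toReal_add (by simpa using h1.ne) (by simp) h2.1 h2.2,
    EReal.toReal_coe_ennreal]

variable {A : Set X}

theorem memBreve.admissible (hker : IsKernel κ) (hep : EnergyPrinciple κ)
    (hp : memEplus κ ϑp) (hm : memEplus κ ϑm)
    (hf : ∀ x, f x = (potential κ ϑp x : EReal) - (potential κ ϑm x : EReal))
    {μ : Measure X} (h : memBreve κ A μ) : Admissible κ A f μ := by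
  have := h.isFiniteMeasure
  exact ⟨h, fieldIntegrable_of_memEplus hker hep hp hm hf h.1⟩

theorem memBreve_midpoint (hker : IsKernel κ) (hep : EnergyPrinciple κ) {μ ν : Measure X}
    (hμ : memBreve κ A μ) (hν : memBreve κ A ν) :
    memBreve κ A ((1 / 2 : ℝ≥0) • μ + (1 / 2 : ℝ≥0) • ν) := by
  have := hμ.isFiniteMeasure
  have := hν.isFiniteMeasure
  refine ⟨memEplus_add hker hep (memEplus_smul hker hep hμ.1 _) (memEplus_smul hker hep hν.1 _),
    fun K hK => ?_, ?_⟩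
  · simp [hμ.2.1 K hK, hν.2.1 K hK]
  · rw [Measure.add_apply, Measure.smul_apply, Measure.smul_apply, hμ.2.2, hν.2.2]
    simp only [ENNReal.smul_def, smul_eq_mul, mul_one]
    rw [← ENNReal.coe_add, ← ENNReal.coe_one]
    congr 1
    norm_num

theorem strongDist_sq_le (hker : IsKernel κ) (hep : EnergyPrinciple κ)
    (hp : memEplus κ ϑp) (hm : memEplus κ ϑm)
    (hf : ∀ x, f x = (potential κ ϑp x : EReal) - (potential κ ϑm x : EReal))
    {w : ℝ} (hw : ∀ μ, Admissible κ A f μ → w ≤ gaussI κ f μ) {μ ν : Measure X}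
    (hμ : memBreve κ A μ) (hν : memBreve κ A ν) :
    strongDist κ μ ν ^ 2 ≤ 2 * (gaussI κ f μ + gaussI κ f ν) - 4 * w := by
  have := hμ.isFiniteMeasure
  have := hν.isFiniteMeasure
  have hmid := memBreve_midpoint hker hep hμ hν
  have h := hw _ (hmid.admissible hker hep hp hm hf)
  have hμ2 := memEplus_smul hker hep hμ.1 (1 / 2)
  have hν2 := memEplus_smul hker hep hν.1 (1 / 2)
  rw [gaussI_eq hker hep hp hm hf hmid.1, form_add_self hker hep hμ2 hν2,
    form_add_right hker hep hp hμ2 hν2, form_add_right hker hep hm hμ2 hν2] at h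
  simp only [form_smul_left, form_smul_right, NNReal.coe_div, NNReal.coe_one,
    NNReal.coe_ofNat] at h
  rw [strongDist_sq hker hep hμ.1 hν.1, gaussI_eq hker hep hp hm hf hμ.1,
    gaussI_eq hker hep hp hm hf hν.1]
  linarith

theorem IsSolution.unique (hker : IsKernel κ) (hep : EnergyPrinciple κ)
    (hp : memEplus κ ϑp) (hm : memEplus κ ϑm)
    (hf : ∀ x, f x = (potential κ ϑp x : EReal) - (potential κ ϑm x : EReal))
    {μ ν : Measure X} (hμ : IsSolution κ A f μ) (hν : IsSolution κ A f ν) : μ = ν := by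
  rw [isSolution_iff] at hμ hν
  have := hν.1.1.isFiniteMeasure
  have h := strongDist_sq_le hker hep hp hm hf hμ.2 hμ.1.1 hν.1.1
  have h' := hν.2 μ hμ.1
  rw [strongDist_sq hker hep hμ.1.1.1 hν.1.1.1] at h
  exact eq_of_two_mul_form_ge hker hep hμ.1.1.1 hν.1.1.1 (by linarith)

end GaussFunctional

section Existence

theorem Concentrated.measure_compl_eq_zero {X : Type*} [TopologicalSpace X] [T2Space X]
    [MeasurableSpace X] {K : Set X} {μ : Measure X} [μ.Regular] (hK : IsCompact K)
    (h : Concentrated μ K) : μ Kᶜ = 0 := by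
  rw [hK.isClosed.isOpen_compl.measure_eq_iSup_isCompact]
  refine le_antisymm (iSup₂_le fun C hC => iSup_le fun hC' => ?_) bot_le
  exact (measure_mono (subset_inter hC subset_rfl)).trans (h C hC').le

theorem integral_eq_one_of_eqOn {X : Type*} [MeasurableSpace X] {K : Set X} {μ : Measure X}
    (hμ : μ Kᶜ = 0) (hμ1 : μ univ = 1) {φ : X → ℝ} (hφ : EqOn φ 1 K) : ∫ x, φ x ∂μ = 1 := by
  have h : φ =ᵐ[μ] fun _ => 1 := by
    filter_upwards [mem_ae_iff.2 hμ] with x hx using hφ hx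
  rw [integral_congr_ae h]
  simp [measureReal_def, hμ1]

variable {X : Type*} [TopologicalSpace X] [T2Space X] [LocallyCompactSpace X]
  [MeasurableSpace X] [BorelSpace X] {κ : X → X → ℝ≥0∞} {K : Set X}

theorem VagueTendstoSeq.measure_compl_eq_zero (hK : IsCompact K) {μ : ℕ → Measure X}
    {μ₀ : Measure X} [μ₀.Regular] (h : VagueTendstoSeq μ μ₀) (hμ : ∀ n, μ n Kᶜ = 0) :
    μ₀ Kᶜ = 0 := by
  rw [hK.isClosed.isOpen_compl.measure_eq_iSup_isCompact]
  refine le_antisymm (iSup₂_le fun C hC => iSup_le fun hC' => ?_) bot_le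
  obtain ⟨φ, hφ1, hφ0, hφc, hφ⟩ := exists_continuous_one_zero_of_isCompact hC' hK.isClosed
    (disjoint_left.2 fun x hx => hC hx)
  have hlim := h φ φ.continuous hφc
  have hn : ∀ n, ∫ x, φ x ∂(μ n) = 0 := fun n => integral_eq_zero_of_ae <| by
    filter_upwards [mem_ae_iff.2 (hμ n)] with x hx using hφ0 hx
  simp_rw [hn] at hlim
  have h0 := tendsto_nhds_unique hlim tendsto_const_nhds
  rw [integral_eq_zero_iff_of_nonneg (fun x => (hφ x).1)
    (φ.continuous.integrable_of_hasCompactSupport hφc)] at h0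
  refine (measure_mono_null (fun x hx => ?_) (ae_iff.1 h0)).le
  simp [hφ1 hx]

theorem VagueTendstoSeq.measure_univ_eq_one (hK : IsCompact K) {μ : ℕ → Measure X}
    {μ₀ : Measure X} [μ₀.Regular] (h : VagueTendstoSeq μ μ₀) (hμ : ∀ n, μ n Kᶜ = 0)
    (hμ1 : ∀ n, μ n univ = 1) : μ₀ univ = 1 := by
  obtain ⟨φ, hφ1, -, hφc, hφ⟩ := exists_continuous_one_zero_of_isCompact hK isClosed_empty
    (disjoint_empty K)
  have hlim := h φ φ.continuous hφc
  simp_rw [fun n => integral_eq_one_of_eqOn (hμ n) (hμ1 n) hφ1] at hlim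
  have h1 := tendsto_nhds_unique hlim tendsto_const_nhds
  have hK0 := h.measure_compl_eq_zero hK hμ
  have hφ' : φ =ᵐ[μ₀] fun _ => 1 := by
    filter_upwards [mem_ae_iff.2 hK0] with x hx using hφ1 hx
  rw [integral_congr_ae hφ'] at h1
  rw [integral_const, smul_eq_mul, mul_one, measureReal_def] at h1
  rwa [ENNReal.toReal_eq_one_iff] at h1

variable {f : X → EReal} {ϑp ϑm : Measure X}

theorem neg_form_self_le_gaussI (hker : IsKernel κ) (hep : EnergyPrinciple κ)
    (hp : memEplus κ ϑp) (hm : memEplus κ ϑm)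
    (hf : ∀ x, f x = (potential κ ϑp x : EReal) - (potential κ ϑm x : EReal))
    {μ : Measure X} [IsFiniteMeasure μ] (hμ : memEplus κ μ) :
    -form κ ϑm ϑm ≤ gaussI κ f μ := by
  rw [gaussI_eq hker hep hp hm hf hμ]
  linarith [two_mul_form_le hker hep hm hμ, form_nonneg κ ϑp μ]

theorem tendsto_gaussI_of_strongDist (hker : IsKernel κ) (hep : EnergyPrinciple κ)
    (hp : memEplus κ ϑp) (hm : memEplus κ ϑm)
    (hf : ∀ x, f x = (potential κ ϑp x : EReal) - (potential κ ϑm x : EReal))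
    {ι : Type*} {F : Filter ι} {μ : ι → Measure X} {ν : Measure X} (hν : memEplus κ ν)
    [IsFiniteMeasure ν] (hμ : ∀ᶠ i in F, memEplus κ (μ i) ∧ IsFiniteMeasure (μ i))
    (h : Tendsto (fun i => strongDist κ (μ i) ν) F (𝓝 0)) :
    Tendsto (fun i => gaussI κ f (μ i)) F (𝓝 (gaussI κ f ν)) := by
  rw [gaussI_eq hker hep hp hm hf hν]
  refine ((tendsto_form_self_of_strongDist hker hep hν hμ h).add
    (((tendsto_form_of_strongDist hker hep hp hν hμ h).sub
      (tendsto_form_of_strongDist hker hep hm hν hμ h)).const_mul 2)).congr' ?_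
  filter_upwards [hμ] with i hi
  have := hi.2
  rw [gaussI_eq hker hep hp hm hf hi.1]

theorem tendsto_wConst_of_strongDist (hker : IsKernel κ) (hep : EnergyPrinciple κ)
    (hp : memEplus κ ϑp) (hm : memEplus κ ϑm)
    (hf : ∀ x, f x = (potential κ ϑp x : EReal) - (potential κ ϑm x : EReal))
    {ι : Type*} {F : Filter ι} {μ : ι → Measure X} {ν : Measure X} (hν : memEplus κ ν)
    [IsFiniteMeasure ν] (hμ : ∀ᶠ i in F, memEplus κ (μ i) ∧ IsFiniteMeasure (μ i))
    (h : Tendsto (fun i => strongDist κ (μ i) ν) F (𝓝 0)) :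
    Tendsto (fun i => wConst κ f (μ i)) F (𝓝 (wConst κ f ν)) := by
  rw [wConst_eq hker hep hp hm hf hν]
  refine ((tendsto_form_self_of_strongDist hker hep hν hμ h).add
    ((tendsto_form_of_strongDist hker hep hp hν hμ h).sub
      (tendsto_form_of_strongDist hker hep hm hν hμ h))).congr' ?_
  filter_upwards [hμ] with i hi
  have := hi.2
  rw [wConst_eq hker hep hp hm hf hi.1]

theorem exists_minimizing_seq {A : Set X} (hker : IsKernel κ) (hep : EnergyPrinciple κ)
    (hp : memEplus κ ϑp) (hm : memEplus κ ϑm)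
    (hf : ∀ x, f x = (potential κ ϑp x : EReal) - (potential κ ϑm x : EReal))
    (hA : ∃ μ, Admissible κ A f μ) :
    ∃ (w : ℝ) (μ : ℕ → Measure X), (∀ ν, Admissible κ A f ν → w ≤ gaussI κ f ν) ∧
      (∀ n, Admissible κ A f (μ n)) ∧ ∀ n : ℕ, gaussI κ f (μ n) < w + 1 / (n + 1) := by
  set S := gaussI κ f '' {μ | Admissible κ A f μ}
  have hS : S.Nonempty := hA.imp' (gaussI κ f) fun μ hμ => mem_image_of_mem _ hμ
  have hbdd : BddBelow S := ⟨-form κ ϑm ϑm, by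
    rintro _ ⟨μ, hμ, rfl⟩
    have := hμ.1.isFiniteMeasure
    exact neg_form_self_le_gaussI hker hep hp hm hf hμ.1.1⟩
  have h : ∀ n : ℕ, ∃ μ, Admissible κ A f μ ∧ gaussI κ f μ < sInf S + 1 / (n + 1) := fun n => by
    obtain ⟨_, ⟨μ, hμ, rfl⟩, hlt⟩ :=
      Real.lt_sInf_add_pos hS (Nat.one_div_pos_of_nat (α := ℝ) (n := n))
    exact ⟨μ, hμ, hlt⟩
  choose μ hμ hμw using h
  exact ⟨sInf S, μ, fun ν hν => csInf_le hbdd (mem_image_of_mem _ hν), hμ, hμw⟩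

/-- The Gauss variational problem for a compact set is solvable as soon as it is not void. -/
theorem exists_isSolution_of_isCompact (hker : IsKernel κ) (hperf : IsPerfect κ)
    (hp : memEplus κ ϑp) (hm : memEplus κ ϑm)
    (hf : ∀ x, f x = (potential κ ϑp x : EReal) - (potential κ ϑm x : EReal))
    (hK : IsCompact K) (hne : ∃ μ, Admissible κ K f μ) : ∃ μ, IsSolution κ K f μ := by
  obtain ⟨hep, hcomplete, hvague⟩ := hperf
  obtain ⟨w, μ, hw, hμ, hμw⟩ := exists_minimizing_seq hker hep hp hm hf hne
  have hcauchy : StrongCauchySeq κ μ := fun ε hε => by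
    obtain ⟨N, hN⟩ := exists_nat_one_div_lt (show 0 < ε ^ 2 / 4 by positivity)
    refine ⟨N, fun m hmN n hnN => lt_of_pow_lt_pow_left₀ 2 hε.le ?_⟩
    have h1 := strongDist_sq_le hker hep hp hm hf hw (hμ m).1 (hμ n).1
    have h2 := Nat.one_div_le_one_div (α := ℝ) hmN
    have h3 := Nat.one_div_le_one_div (α := ℝ) hnN
    linarith [hμw m, hμw n]
  obtain ⟨μ₀, hμ₀, hlim⟩ := hcomplete μ (fun n => (hμ n).1.1) hcauchy
  have : μ₀.Regular := hμ₀.1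
  have hv := hvague μ μ₀ (fun n => (hμ n).1.1) hμ₀ hlim
  have hnull : ∀ n, μ n Kᶜ = 0 := fun n => by
    have : (μ n).Regular := (hμ n).1.1.1
    exact (hμ n).1.2.1.measure_compl_eq_zero hK
  have hmem : memBreve κ K μ₀ :=
    ⟨hμ₀, fun C _ => measure_mono_null inter_subset_left (hv.measure_compl_eq_zero hK hnull),
      hv.measure_univ_eq_one hK hnull fun n => (hμ n).1.2.2⟩
  have := hmem.isFiniteMeasure
  have hG := tendsto_gaussI_of_strongDist hker hep hp hm hf hμ₀
    (Eventually.of_forall fun n => ⟨(hμ n).1.1, (hμ n).1.isFiniteMeasure⟩) hlim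
  have hle : gaussI κ f μ₀ ≤ w := by
    refine le_of_tendsto_of_tendsto' hG ?_ fun n => (hμw n).le
    simpa using (tendsto_one_div_add_atTop_nhds_zero_nat (𝕜 := ℝ)).const_add w
  exact ⟨μ₀, isSolution_iff.2
    ⟨hmem.admissible hker hep hp hm hf, fun ν hν => hle.trans (hw ν hν)⟩⟩

end Existence

section Approximation

open scoped NNReal

variable {X : Type*} [TopologicalSpace X] [T2Space X] [LocallyCompactSpace X]
  [MeasurableSpace X] [BorelSpace X] {κ : X → X → ℝ≥0∞} {A : Set X} {l : Measure X}

theorem exists_isCompact_subset_measure_compl_lt {X : Type*} [TopologicalSpace X] [T2Space X]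
    [MeasurableSpace X] [BorelSpace X] {A : Set X} {l : Measure X}
    [l.Regular] [IsFiniteMeasure l] (hA : Concentrated l A) {ε : ℝ≥0∞} (hε : ε ≠ 0) :
    ∃ K ⊆ A, IsCompact K ∧ l Kᶜ < ε := by
  obtain ⟨C, -, hC, hCε⟩ := MeasurableSet.univ.exists_isCompact_sdiff_lt (measure_ne_top l _)
    (ENNReal.half_pos hε).ne'
  set N := toMeasurable l (Aᶜ ∩ C)
  have hN : l N = 0 := by rw [measure_toMeasurable, hA C hC]
  obtain ⟨K, hKC, hK, hKε⟩ := (hC.measurableSet.diff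
    (measurableSet_toMeasurable l (Aᶜ ∩ C))).exists_isCompact_sdiff_lt (measure_ne_top l _)
    (ENNReal.half_pos hε).ne'
  refine ⟨K, fun x hx => ?_, hK, ?_⟩
  · by_contra hxA
    exact (hKC hx).2 (subset_toMeasurable l _ ⟨hxA, (hKC hx).1⟩)
  · have hsub : Kᶜ ⊆ (univ \ C ∪ (C \ N) \ K) ∪ N := fun x hx => by
      by_cases h1 : x ∈ C <;> by_cases h2 : x ∈ N <;> simp_all
    calc l Kᶜ ≤ l ((univ \ C ∪ (C \ N) \ K) ∪ N) := measure_mono hsub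
      _ ≤ l (univ \ C ∪ (C \ N) \ K) + l N := measure_union_le _ _
      _ ≤ l (univ \ C) + l ((C \ N) \ K) := by rw [hN, add_zero]; exact measure_union_le _ _
      _ < ε / 2 + ε / 2 := ENNReal.add_lt_add hCε hKε
      _ = ε := ENNReal.add_halves ε

theorem iterEnergy_mono {X : Type*} [MeasurableSpace X] (κ : X → X → ℝ≥0∞)
    {μ μ' ν ν' : Measure X} (hμ : μ ≤ μ') (hν : ν ≤ ν') :
    iterEnergy κ μ ν ≤ iterEnergy κ μ' ν' :=
  lintegral_mono' hμ fun _ => lintegral_mono' hν le_rfl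

theorem memEplus_restrict (hker : IsKernel κ) (hep : EnergyPrinciple κ) [IsFiniteMeasure l]
    (hl : memEplus κ l) (s : Set X) : memEplus κ (l.restrict s) := by
  have : l.Regular := hl.1
  exact (memEplus_iff hker hep _).2
    ⟨Measure.Regular.restrict_of_measure_ne_top (measure_ne_top l s),
      (iterEnergy_mono κ Measure.restrict_le_self Measure.restrict_le_self).trans_lt
        ((memEplus_iff hker hep l).1 hl).2⟩

theorem form_restrict_self_le (hker : IsKernel κ) (hep : EnergyPrinciple κ)
    (hl : memEplus κ l) (s : Set X) :
    form κ (l.restrict s) (l.restrict s) ≤ form κ l l :=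
  ENNReal.toReal_mono (iterEnergy_self_ne_top hker hep hl)
    (iterEnergy_mono κ Measure.restrict_le_self Measure.restrict_le_self)

theorem tendsto_form_restrict (hker : IsKernel κ) (hep : EnergyPrinciple κ) [IsFiniteMeasure l]
    (hl : memEplus κ l) {ϑ : Measure X} (hϑ : memEplus κ ϑ) {K : ℕ → Set X}
    (hK : ∀ n, MeasurableSet (K n)) (hlim : Tendsto (fun n => l (K n)ᶜ) atTop (𝓝 0)) :
    Tendsto (fun n => form κ ϑ (l.restrict (K n))) atTop (𝓝 (form κ ϑ l)) := by
  have hint := integrable_toReal_potential hker hep hϑ hl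
  have h := (hint.tendsto_setIntegral_nhds_zero hlim).const_sub
    (∫ x, (potential κ ϑ x).toReal ∂l)
  rw [sub_zero, integral_toReal_potential hker hep hϑ hl] at h
  refine h.congr fun n => ?_
  rw [← integral_toReal_potential hker hep hϑ hl, ← integral_add_compl (hK n) hint,
    add_sub_cancel_right,
    integral_toReal_potential hker hep hϑ (memEplus_restrict hker hep hl _)]

theorem tendsto_measure_of_tendsto_measure_compl {X : Type*} [MeasurableSpace X] {l : Measure X}
    (hl : l univ = 1) {K : ℕ → Set X} (hK : ∀ n, MeasurableSet (K n))
    (hlim : Tendsto (fun n => l (K n)ᶜ) atTop (𝓝 0)) :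
    Tendsto (fun n => l (K n)) atTop (𝓝 1) := by
  have : IsFiniteMeasure l := ⟨by rw [hl]; exact one_lt_top⟩
  have h := ENNReal.Tendsto.sub (tendsto_const_nhds (x := (1 : ℝ≥0∞))) hlim (Or.inl one_ne_top)
  rw [tsub_zero] at h
  refine h.congr fun n => ?_
  rw [← hl, ← measure_compl (hK n).compl (measure_ne_top l _), compl_compl]

theorem memBreve_normalized_restrict (hker : IsKernel κ) (hep : EnergyPrinciple κ)
    (hl : memBreve κ A l) {K : Set X} (hK : MeasurableSet K) (h0 : l K ≠ 0) :
    memBreve κ K ((l K).toNNReal⁻¹ • l.restrict K) := by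
  have := hl.isFiniteMeasure
  refine ⟨memEplus_smul hker hep (memEplus_restrict hker hep hl.1 K) _, fun C _ => ?_, ?_⟩
  · have : l.restrict K (Kᶜ ∩ C) = 0 :=
      measure_mono_null inter_subset_left (by rw [Measure.restrict_apply hK.compl]; simp)
    simp [this]
  · have hne : (l K).toNNReal ≠ 0 := (ENNReal.toNNReal_ne_zero).2 ⟨h0, measure_ne_top l K⟩
    rw [Measure.smul_apply, Measure.restrict_apply_univ, ENNReal.smul_def, smul_eq_mul,
      ENNReal.coe_inv hne, ENNReal.coe_toNNReal (measure_ne_top l K)]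
    exact ENNReal.inv_mul_cancel h0 (measure_ne_top l K)

variable {f : X → EReal} {ϑp ϑm : Measure X}

theorem exists_isCompact_memBreve_gaussI_le (hker : IsKernel κ) (hep : EnergyPrinciple κ)
    (hp : memEplus κ ϑp) (hm : memEplus κ ϑm)
    (hf : ∀ x, f x = (potential κ ϑp x : EReal) - (potential κ ϑm x : EReal))
    (hl : memBreve κ A l) {ε : ℝ} (hε : 0 < ε) :
    ∃ K ⊆ A, IsCompact K ∧ ∃ ν, memBreve κ K ν ∧ gaussI κ f ν ≤ gaussI κ f l + ε := by
  have := hl.isFiniteMeasure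
  have : l.Regular := hl.1.1
  have h := fun n : ℕ => exists_isCompact_subset_measure_compl_lt hl.2.1
    (ε := (n + 1 : ℝ≥0∞)⁻¹) (ENNReal.inv_ne_zero.2 (by finiteness))
  choose K hKA hK hKlt using h
  have hKm := fun n => (hK n).measurableSet
  have hlim : Tendsto (fun n => l (K n)ᶜ) atTop (𝓝 0) := by
    refine tendsto_of_tendsto_of_tendsto_of_le_of_le tendsto_const_nhds ?_
      (fun _ => bot_le) fun n => (hKlt n).le
    exact_mod_cast (tendsto_add_atTop_iff_nat 1).2 ENNReal.tendsto_inv_nat_nhds_zero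
  have hlim1 := tendsto_measure_of_tendsto_measure_compl hl.2.2 hKm hlim
  set c : ℕ → ℝ≥0 := fun n => (l (K n)).toNNReal⁻¹
  have hc : Tendsto (fun n => (c n : ℝ)) atTop (𝓝 1) := by
    have h1 := (ENNReal.tendsto_toReal one_ne_top).comp hlim1
    rw [ENNReal.toReal_one] at h1
    have h2 := h1.inv₀ one_ne_zero
    rwa [inv_one] at h2
  have hbound := ((hc.pow 2).mul_const (form κ l l)).add
    ((hc.mul ((tendsto_form_restrict hker hep hl.1 hp hKm hlim).sub
      (tendsto_form_restrict hker hep hl.1 hm hKm hlim))).const_mul 2)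
  rw [one_pow, one_mul, one_mul, ← gaussI_eq hker hep hp hm hf hl.1] at hbound
  obtain ⟨n, hn, hn0⟩ := ((hbound.eventually_le_const (lt_add_of_pos_right _ hε)).and
    (hlim1.eventually_ne one_ne_zero)).exists
  have hν := memBreve_normalized_restrict hker hep hl (hKm n) hn0
  have := hν.isFiniteMeasure
  refine ⟨K n, hKA n, hK n, _, hν, ?_⟩
  rw [gaussI_eq hker hep hp hm hf hν.1]
  simp only [form_smul_left, form_smul_right]
  have h1 := mul_le_mul_of_nonneg_left (form_restrict_self_le hker hep hl.1 (K n))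
    (sq_nonneg (c n : ℝ))
  change (c n : ℝ) * (c n * _) + 2 * (c n * _ - c n * _) ≤ _
  linarith

end Approximation

theorem stmt3 {X : Type*} [TopologicalSpace X] [T2Space X] [LocallyCompactSpace X]
    [MeasurableSpace X] [BorelSpace X]
    (κ : X → X → ℝ≥0∞) (f : X → EReal) (A : Set X)
    (hker : IsKernel κ) (hperf : IsPerfect κ)
    (ϑp ϑm : Measure X) (hp : memEplus κ ϑp) (hm : memEplus κ ϑm)
    (hf : ∀ x, f x = (potential κ ϑp x : EReal) - (potential κ ϑm x : EReal))
    (hw : wf κ A f < ⊤)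
    (l : Measure X) (hl : IsSolution κ A f l) :
    ∃ K₀ : Set X, IsCompact K₀ ∧ K₀ ⊆ A ∧
      (∀ K : Set X, IsCompact K → K ⊆ A → K₀ ⊆ K →
        ∃! lK : Measure X, IsSolution κ K f lK) ∧
      ∀ lam : {K : Set X // IsCompact K ∧ K ⊆ A} → Measure X,
        (∀ K : {K : Set X // IsCompact K ∧ K ⊆ A}, K₀ ⊆ K.1 →
          IsSolution κ K.1 f (lam K)) →
        Tendsto (fun K => wConst κ f (lam K)) atTop (𝓝 (wConst κ f l)) := by
  have hep := hperf.1
  rw [isSolution_iff] at hl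
  obtain ⟨hl, hmin⟩ := hl
  have := hl.1.isFiniteMeasure
  obtain ⟨K₀, hK₀A, hK₀, ν₀, hν₀, -⟩ :=
    exists_isCompact_memBreve_gaussI_le hker hep hp hm hf hl.1 one_pos
  refine ⟨K₀, hK₀, hK₀A, fun K hK _ hK₀K => ?_, fun lam hlam => ?_⟩
  · obtain ⟨μ, hμ⟩ := exists_isSolution_of_isCompact hker hperf hp hm hf hK
      ⟨ν₀, (hν₀.mono hK₀K).admissible hker hep hp hm hf⟩
    exact ⟨μ, hμ, fun ν hν => hν.unique hker hep hp hm hf hμ⟩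
  · have hlarge : ∀ᶠ K : {K : Set X // IsCompact K ∧ K ⊆ A} in atTop, K₀ ⊆ K.1 :=
      eventually_ge_atTop (⟨K₀, hK₀, hK₀A⟩ : {K : Set X // IsCompact K ∧ K ⊆ A})
    refine tendsto_wConst_of_strongDist hker hep hp hm hf hl.1.1 ?_ ?_
    · filter_upwards [hlarge] with K hK
      exact ⟨(hlam K hK).1.1.1, (hlam K hK).1.1.isFiniteMeasure⟩
    · rw [Metric.tendsto_nhds]
      intro ε hε
      obtain ⟨K₁, hK₁A, hK₁, ν₁, hν₁, hle⟩ :=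
        exists_isCompact_memBreve_gaussI_le hker hep hp hm hf hl.1
          (show 0 < ε ^ 2 / 4 by positivity)
      have hlarge₁ : ∀ᶠ K : {K : Set X // IsCompact K ∧ K ⊆ A} in atTop, K₁ ⊆ K.1 :=
        eventually_ge_atTop (⟨K₁, hK₁, hK₁A⟩ : {K : Set X // IsCompact K ∧ K ⊆ A})
      filter_upwards [hlarge, hlarge₁] with K hK hK1
      have hsol := isSolution_iff.1 (hlam K hK)
      have h1 := hsol.2 ν₁ ((hν₁.mono hK1).admissible hker hep hp hm hf)
      have h2 := strongDist_sq_le hker hep hp hm hf hmin (hsol.1.1.mono K.2.2) hl.1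
      have h0 : 0 ≤ strongDist κ (lam K) l := Real.sqrt_nonneg _
      rw [Real.dist_0_eq_abs, abs_of_nonneg h0]
      refine lt_of_pow_lt_pow_left₀ 2 hε.le ?_
      have : 0 < ε ^ 2 := by positivity
      linarith

end GaussVar
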